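/- A finite quantum binomial set (X,r) is a symmetric set (i.e. r satisfies the braid relation r¹² ∘ r²³ ∘ r¹² = r²³ ∘ r¹² ∘ r²³ on X³) if and only if the following two conditions on the cardinalities of the D-orbits in X³ hold: (a) a D-orbit O satisfies O ∩ (((Δ₂ × X) ∪ (X × Δ₂)) \ Δ₃) ≠ ∅ if and only if |O| = 3; and (b) a D-orbit O satisfies O ∩ ((Δ₂ × X) ∪ (X × Δ₂)) = ∅ if and only if |O| = 6. -/

import Mathlib

def orbAux {P : Type*} (a b : P → P) (p : P) : Set P :=
  {q | Relation.EqvGen (fun x y => a x = y ∨ b x = y) p q}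

theorem orbAux_self {P : Type*} (a b : P → P) (p : P) : p ∈ orbAux a b p :=
  Relation.EqvGen.refl p

theorem orbAux_a {P : Type*} (a b : P → P) (p q : P) (h : q ∈ orbAux a b p) :
    a q ∈ orbAux a b p :=
  Relation.EqvGen.trans _ _ _ h (Relation.EqvGen.rel _ _ (Or.inl rfl))

theorem orbAux_b {P : Type*} (a b : P → P) (p q : P) (h : q ∈ orbAux a b p) :
    b q ∈ orbAux a b p :=
  Relation.EqvGen.trans _ _ _ h (Relation.EqvGen.rel _ _ (Or.inr rfl))

theorem orbAux_sub {P : Type*} (a b : P → P) (ha : Function.Involutive a)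
    (hb : Function.Involutive b) (p : P) (S : Set P) (hp : p ∈ S)
    (hSa : ∀ q ∈ S, a q ∈ S) (hSb : ∀ q ∈ S, b q ∈ S) : orbAux a b p ⊆ S := by
  have key : ∀ x y, Relation.EqvGen (fun x y => a x = y ∨ b x = y) x y → (x ∈ S ↔ y ∈ S) := by
    intro x y h
    induction h with
    | rel x y h =>
      rcases h with h | h
      · subst h; exact ⟨hSa x, fun h => by simpa [ha x] using hSa _ h⟩
      · subst h; exact ⟨hSb x, fun h => by simpa [hb x] using hSb _ h⟩
    | refl x => rfl
    | symm x y _ ih => exact ih.symm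
    | trans x y z _ _ h1 h2 => exact h1.trans h2
  intro q hq
  exact (key p q hq).1 hp

theorem orbAux_eq {P : Type*} (a b : P → P) (p q : P) (h : q ∈ orbAux a b p) :
    orbAux a b p = orbAux a b q := by
  ext s
  exact ⟨fun hs => Relation.EqvGen.trans _ _ _ (Relation.EqvGen.symm _ _ h) hs,
    fun hs => Relation.EqvGen.trans _ _ _ h hs⟩

theorem orbAux_comm {P : Type*} (a b : P → P) (p : P) : orbAux a b p = orbAux b a p := by
  unfold orbAux
  have : (fun x y => a x = y ∨ b x = y) = (fun x y => b x = y ∨ a x = y) := by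
    funext x y; exact propext or_comm
  rw [this]

/-- braid, fixed by `a` only: the orbit is a path of length three -/
theorem card3_aux {P : Type*} (a b : P → P) (ha : Function.Involutive a)
    (hb : Function.Involutive b)
    (h2 : ∀ p, a p = p → a (b p) = b p → b p = p)
    (hbr : ∀ p, a (b (a p)) = b (a (b p))) (q : P) (h1 : a q = q) (hn : b q ≠ q) :
    (orbAux a b q).ncard = 3 := by
  have e : b (a (b q)) = a (b q) := by rw [← hbr, h1]
  have : orbAux a b q = {q, b q, a (b q)} := by
    apply Set.Subset.antisymm
    · apply orbAux_sub a b ha hb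
      · simp
      · rintro s (rfl | rfl | rfl)
        · simp [h1]
        · simp
        · simp [ha (b q)]
      · rintro s (rfl | rfl | rfl)
        · simp
        · simp [hb q]
        · simp [e]
    · have i1 := orbAux_self a b q
      have i2 := orbAux_b a b q q i1
      have i3 := orbAux_a a b q _ i2
      rintro s (rfl | rfl | rfl) <;> assumption
  rw [this, Set.ncard_eq_three]
  refine ⟨q, b q, a (b q), hn.symm, ?_, ?_, rfl⟩
  · intro h
    have := congrArg a h
    rw [ha, h1] at this
    exact hn this.symm
  · intro h
    exact hn (h2 q h1 h.symm)

theorem card6_set {P : Type*} (a b : P → P) (ha : Function.Involutive a)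
    (hb : Function.Involutive b) (h : ∀ p, a p = b p → a p = p) (q : P)
    (hfa : a q ≠ q) (hfb : b q ≠ q) (hfba : a (b q) ≠ b q) (hfab : b (a q) ≠ a q)
    (hf5 : a (b (a q)) ≠ b (a q)) (hne : b (a q) ≠ a (b q)) :
    ({a (b (a q)), q, a q, b q, a (b q), b (a q)} : Set P).ncard = 6 := by
  classical
  have hab : a q ≠ b q := fun e => hfa (h q e)
  have A : ∀ x y, a x = y → x = a y := fun x y e => by rw [← e, ha]
  have B : ∀ x y, b x = y → x = b y := fun x y e => by rw [← e, hb]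
  have i1 := ha.injective
  have i2 := hb.injective
  have key : ({a (b (a q)), q, a q, b q, a (b q), b (a q)} : Set P) =
    (({a (b (a q)), q, a q, b q, a (b q), b (a q)} : Finset P) : Set P) := by simp
  rw [key, Set.ncard_coe_finset]
  have n1 : a (b (a q)) ≠ q := fun e => hfab (A _ _ e)
  have n2 : a (b (a q)) ≠ a q := fun e => hab (B _ _ (i1 e))
  have n3 : a (b (a q)) ≠ b q := fun e => hne (A _ _ e)
  have n4 : a (b (a q)) ≠ a (b q) := fun e => hfa (i2 (i1 e))
  have n6 : q ≠ a (b q) := fun e => hab (A _ _ e.symm).symm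
  have n7 : q ≠ b (a q) := fun e => hab (B _ _ e.symm)
  have n8 : a q ≠ a (b q) := fun e => hfb (i1 e).symm
  have n9 : b q ≠ b (a q) := fun e => hfa (i2 e).symm
  rw [Finset.card_insert_of_notMem, Finset.card_insert_of_notMem, Finset.card_insert_of_notMem,
    Finset.card_insert_of_notMem, Finset.card_pair hne.symm]
  · simp [hfba.symm, n9]
  · simp [hab, n8, hfab.symm]
  · simp [hfa.symm, hfb.symm, n6, n7]
  · simp [n1, n2, n3, n4, hf5]

theorem six_sub {P : Type*} (a b : P → P) (q : P) :
    ({a (b (a q)), q, a q, b q, a (b q), b (a q)} : Set P) ⊆ orbAux a b q := by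
  have i1 := orbAux_self a b q
  have i2 := orbAux_b a b q q i1
  have i3 := orbAux_a a b q _ i2
  have i4 := orbAux_a a b q q i1
  have i5 := orbAux_b a b q _ i4
  have i6 := orbAux_a a b q _ i5
  rintro s (rfl | rfl | rfl | rfl | rfl | rfl) <;> assumption

/-- braid, no fixed points: the orbit has six elements -/
theorem card6_aux {P : Type*} (a b : P → P) (ha : Function.Involutive a)
    (hb : Function.Involutive b) (h : ∀ p, a p = b p → a p = p)
    (hbr : ∀ p, a (b (a p)) = b (a (b p))) (q : P)
    (hf : ∀ s ∈ orbAux a b q, a s ≠ s ∧ b s ≠ s) :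
    (orbAux a b q).ncard = 6 := by
  have i1 := orbAux_self a b q
  have i2 := orbAux_b a b q q i1
  have i4 := orbAux_a a b q q i1
  have i5 := orbAux_b a b q _ i4
  have hne : b (a q) ≠ a (b q) := by
    intro e
    have e1 : a (b (a q)) = b q := by rw [e, ha]
    have e2 : b (a (b q)) = a q := by rw [← e, hb]
    exact (hf q i1).1 (h q ((e2.symm.trans (hbr q).symm).trans e1))
  rw [← card6_set a b ha hb h q (hf _ i1).1 (hf _ i1).2 (hf _ i2).1 (hf _ i4).2 (hf _ i5).1 hne]
  congr 1
  apply Set.Subset.antisymm _ (six_sub a b q)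
  apply orbAux_sub a b ha hb
  · simp
  · rintro s (rfl | rfl | rfl | rfl | rfl | rfl) <;> simp [ha _]
  · rintro s (rfl | rfl | rfl | rfl | rfl | rfl) <;> simp [hb _, hbr]

/-- an orbit without fixed points and with six elements satisfies braid -/
theorem braid6_aux {P : Type*} [Finite P] (a b : P → P) (ha : Function.Involutive a)
    (hb : Function.Involutive b) (h : ∀ p, a p = b p → a p = p) (q : P)
    (hf : ∀ s ∈ orbAux a b q, a s ≠ s ∧ b s ≠ s)
    (hc : (orbAux a b q).ncard = 6) : a (b (a q)) = b (a (b q)) := by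
  have i1 := orbAux_self a b q
  have i2 := orbAux_b a b q q i1
  have i3 := orbAux_a a b q _ i2
  have i4 := orbAux_a a b q q i1
  have i5 := orbAux_b a b q _ i4
  have hab : a q ≠ b q := fun e => (hf q i1).1 (h q e)
  have hne : b (a q) ≠ a (b q) := by
    intro e
    have hs : orbAux a b q ⊆ {q, a q, b q, a (b q)} := by
      apply orbAux_sub a b ha hb
      · simp
      · rintro s (rfl | rfl | rfl | rfl) <;> simp [ha _]
      · rintro s (rfl | rfl | rfl | rfl)
        · simp
        · simp [e]
        · simp [hb _]
        · simp [← e, hb _]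
    have l := Set.ncard_le_ncard hs (Set.toFinite _)
    have l1 := Set.ncard_insert_le q {a q, b q, a (b q)}
    have l2 := Set.ncard_insert_le (a q) {b q, a (b q)}
    have l3 := Set.ncard_insert_le (b q) {a (b q)}
    have l4 := Set.ncard_singleton (a (b q))
    omega
  have c := card6_set a b ha hb h q (hf _ i1).1 (hf _ i1).2 (hf _ i2).1 (hf _ i4).2 (hf _ i5).1 hne
  have e := Set.eq_of_subset_of_ncard_le (six_sub a b q) (by omega) (Set.toFinite _)
  have m := orbAux_b a b q _ i3
  rw [← e] at m
  have A : ∀ x y, a x = y → x = a y := fun x y e => by rw [← e, ha]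
  have B : ∀ x y, b x = y → x = b y := fun x y e => by rw [← e, hb]
  have j1 := ha.injective
  have j2 := hb.injective
  rcases m with m | m | m | m | m | m
  · exact m.symm
  · exact absurd (B _ _ m) (hf _ i2).1
  · exact absurd (B _ _ m).symm hne
  · exact absurd (A _ _ (j2 m)).symm hab
  · exact absurd m (hf _ i3).2
  · exact absurd (j1 (j2 m)) (hf _ i1).2

/-- an orbit with three elements containing an `a`-fixed point satisfies braid -/
theorem braid3_aux {P : Type*} [Finite P] (a b : P → P) (ha : Function.Involutive a)
    (hb : Function.Involutive b)
    (h2 : ∀ p, a p = p → a (b p) = b p → b p = p) (q : P) (h1 : a q = q) (hn : b q ≠ q)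
    (hc : (orbAux a b q).ncard = 3) :
    ∀ s ∈ orbAux a b q, a (b (a s)) = b (a (b s)) := by
  have i1 := orbAux_self a b q
  have i2 := orbAux_b a b q q i1
  have i3 := orbAux_a a b q _ i2
  have i4 := orbAux_b a b q _ i3
  have A : ∀ x y, a x = y → x = a y := fun x y e => by rw [← e, ha]
  have B : ∀ x y, b x = y → x = b y := fun x y e => by rw [← e, hb]
  have n1 : a (b q) ≠ b q := fun e => hn (h2 q h1 e)
  have n2 : q ≠ a (b q) := fun e => hn ((A _ _ e.symm).trans h1)
  have c : ({q, b q, a (b q)} : Set P).ncard = 3 :=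
    Set.ncard_eq_three.2 ⟨_, _, _, hn.symm, n2, n1.symm, rfl⟩
  have sub : ({q, b q, a (b q)} : Set P) ⊆ orbAux a b q := by
    rintro s (rfl | rfl | rfl) <;> assumption
  have e := Set.eq_of_subset_of_ncard_le sub (by omega) (Set.toFinite _)
  rw [← e] at i4
  have f : b (a (b q)) = a (b q) := by
    rcases i4 with m | m | m
    · exact absurd (B _ _ m) n1
    · exact absurd (hb.injective m).symm n2
    · exact m
  rw [← e]
  rintro s (rfl | rfl | rfl)
  · rw [h1, f]
  · rw [f, ha, hb, h1]
  · rw [ha, hb, f, ha, hb, h1]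

theorem main_aux {P : Type*} [Finite P] (a b : P → P) (ha : Function.Involutive a)
    (hb : Function.Involutive b) (h : ∀ p, a p = b p → a p = p)
    (h2 : ∀ p, a p = p → a (b p) = b p → b p = p)
    (h3 : ∀ p, b p = p → b (a p) = a p → a p = p) :
    (∀ p, a (b (a p)) = b (a (b p))) ↔
      ((∀ p, ((∃ q ∈ orbAux a b p, (a q = q ∨ b q = q) ∧ ¬ (a q = q ∧ b q = q)) ↔
        (orbAux a b p).ncard = 3)) ∧
       (∀ p, ((∀ q ∈ orbAux a b p, ¬ (a q = q ∨ b q = q)) ↔ (orbAux a b p).ncard = 6))) := by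
  constructor
  · intro hbr
    have k3 : ∀ p, (∃ q ∈ orbAux a b p, (a q = q ∨ b q = q) ∧ ¬ (a q = q ∧ b q = q)) →
        (orbAux a b p).ncard = 3 := by
      rintro p ⟨q, hq, hq1 | hq1, hq2⟩
      · rw [orbAux_eq a b p q hq]
        exact card3_aux a b ha hb h2 hbr q hq1 (fun e => hq2 ⟨hq1, e⟩)
      · rw [orbAux_eq a b p q hq, orbAux_comm]
        exact card3_aux b a hb ha h3 (fun p => (hbr p).symm) q hq1 (fun e => hq2 ⟨e, hq1⟩)
    have k6 : ∀ p, (∀ q ∈ orbAux a b p, ¬ (a q = q ∨ b q = q)) →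
        (orbAux a b p).ncard = 6 := by
      intro p hp
      exact card6_aux a b ha hb h hbr p (fun s hs => not_or.1 (hp s hs))
    have k1 : ∀ p, (∃ q ∈ orbAux a b p, a q = q ∧ b q = q) → (orbAux a b p).ncard ≤ 1 := by
      rintro p ⟨q, hq, e1, e2⟩
      rw [orbAux_eq a b p q hq, ← Set.ncard_singleton q]
      apply Set.ncard_le_ncard _ (Set.toFinite _)
      apply orbAux_sub a b ha hb
      · simp
      · rintro s rfl; simpa using e1
      · rintro s rfl; simpa using e2
    refine ⟨fun p => ⟨k3 p, fun hc => ?_⟩, fun p => ⟨k6 p, fun hc q hq hf => ?_⟩⟩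
    · by_contra hcon
      by_cases h6 : ∀ q ∈ orbAux a b p, ¬ (a q = q ∨ b q = q)
      · have := k6 p h6
        omega
      · push Not at h6
        obtain ⟨q, hq, hf⟩ := h6
        by_cases hd : a q = q ∧ b q = q
        · have := k1 p ⟨q, hq, hd⟩
          omega
        · exact hcon ⟨q, hq, hf, hd⟩
    · by_cases hd : a q = q ∧ b q = q
      · have := k1 p ⟨q, hq, hd⟩
        omega
      · have := k3 p ⟨q, hq, hf, hd⟩
        omega
  · rintro ⟨H3, H6⟩ p
    by_cases h6 : ∀ q ∈ orbAux a b p, ¬ (a q = q ∨ b q = q)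
    · exact braid6_aux a b ha hb h p (fun s hs => not_or.1 (h6 s hs)) ((H6 p).1 h6)
    · push Not at h6
      obtain ⟨q, hq, hf⟩ := h6
      by_cases hd : a q = q ∧ b q = q
      · have hs : orbAux a b q ⊆ {q} := by
          apply orbAux_sub a b ha hb
          · simp
          · rintro s rfl; simpa using hd.1
          · rintro s rfl; simpa using hd.2
        have := orbAux_self a b p
        rw [orbAux_eq a b p q hq] at this
        have e : p = q := hs this
        subst e
        simp [hd.1, hd.2]
      · have c := (H3 p).1 ⟨q, hq, hf, hd⟩
        have m := orbAux_self a b p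
        rw [orbAux_eq a b p q hq] at c m
        rcases hf with hf | hf
        · exact braid3_aux a b ha hb h2 q hf (fun e => hd ⟨hf, e⟩) c p m
        · rw [orbAux_comm] at c m
          exact (braid3_aux b a hb ha h3 q hf (fun e => hd ⟨e, hf⟩) c p m).symm


/-- The map r¹² = r × id acting on X³ (realized as `X × X × X`). -/
def r12 {X : Type*} (r : X × X → X × X) : X × X × X → X × X × X :=
  fun p => ((r (p.1, p.2.1)).1, (r (p.1, p.2.1)).2, p.2.2)

/-- The map r²³ = id × r acting on X³. -/
def r23 {X : Type*} (r : X × X → X × X) : X × X × X → X × X × X :=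
  fun p => (p.1, (r (p.2.1, p.2.2)).1, (r (p.2.1, p.2.2)).2)

/-- One step of the action of the group D(r) generated by r¹² and r²³. -/
def dStep {X : Type*} (r : X × X → X × X) (a b : X × X × X) : Prop :=
  r12 r a = b ∨ r23 r a = b

/-- `O` is an orbit of the group D(r) = ⟨r¹², r²³⟩ acting on X³. -/
def IsDOrbit {X : Type*} (r : X × X → X × X) (O : Set (X × X × X)) : Prop :=
  ∃ a, O = {b | Relation.EqvGen (dStep r) a b}

/-- `(X,r)` is a quantum binomial set: `r` is involutive, nondegenerate
(left and right actions are bijective) and square-free. -/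
def IsQuantumBinomial {X : Type*} (r : X × X → X × X) : Prop :=
  Function.Involutive r ∧
  (∀ x : X, Function.Bijective (fun y => (r (x, y)).1)) ∧
  (∀ x : X, Function.Bijective (fun y => (r (y, x)).2)) ∧
  (∀ x : X, r (x, x) = (x, x))

/-- The subset Δ₂ × X of X³. -/
def Diag2X {X : Type*} : Set (X × X × X) := {p | p.1 = p.2.1}

/-- The subset X × Δ₂ of X³. -/
def XDiag2 {X : Type*} : Set (X × X × X) := {p | p.2.1 = p.2.2}

/-- The diagonal Δ₃ of X³. -/
def Diag3 {X : Type*} : Set (X × X × X) := {p | p.1 = p.2.1 ∧ p.2.1 = p.2.2}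

/-- `(X,r)` is braided: the braid relation r¹²r²³r¹² = r²³r¹²r²³ holds on X³. -/
def IsBraided {X : Type*} (r : X × X → X × X) : Prop :=
  (r12 r) ∘ (r23 r) ∘ (r12 r) = (r23 r) ∘ (r12 r) ∘ (r23 r)

/-- A finite quantum binomial set is symmetric (satisfies the braid relation)
iff: (a) a D-orbit meets ((Δ₂ × X) ∪ (X × Δ₂)) \ Δ₃ iff it has exactly 3
elements, and (b) a D-orbit is disjoint from (Δ₂ × X) ∪ (X × Δ₂) iff it has
exactly 6 elements. -/
theorem symmetric_iff_orbit_cards {X : Type*} [Fintype X]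
    (r : X × X → X × X) (hqb : IsQuantumBinomial r) :
    IsBraided r ↔
      ((∀ O : Set (X × X × X), IsDOrbit r O →
          ((O ∩ ((Diag2X ∪ XDiag2) \ Diag3)).Nonempty ↔ O.ncard = 3)) ∧
       (∀ O : Set (X × X × X), IsDOrbit r O →
          (O ∩ (Diag2X ∪ XDiag2) = ∅ ↔ O.ncard = 6))) := by
  obtain ⟨hinv, hl, hr, hsq⟩ := hqb
  have L : ∀ x y, (r (x, y)).1 = x → x = y := by
    intro x y e
    apply (hl x).1
    simp [hsq, e]
  have R : ∀ x y, (r (x, y)).2 = y → x = y := by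
    intro x y e
    apply (hr y).1
    simp [hsq, e]
  have ha : Function.Involutive (r12 r) := by
    rintro ⟨x, y, z⟩
    simp [r12, hinv (x, y)]
  have hb : Function.Involutive (r23 r) := by
    rintro ⟨x, y, z⟩
    simp [r23, hinv (y, z)]
  have fa : ∀ p, r12 r p = p ↔ p ∈ Diag2X := by
    rintro ⟨x, y, z⟩
    constructor
    · intro e
      exact L x y (congrArg Prod.fst e)
    · intro e
      have e : x = y := e
      subst e
      simp [r12, hsq]
  have fb : ∀ p, r23 r p = p ↔ p ∈ XDiag2 := by
    rintro ⟨x, y, z⟩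
    constructor
    · intro e
      exact L y z (congrArg (fun t => t.2.1) e)
    · intro e
      have e : y = z := e
      subst e
      simp [r23, hsq]
  have M := main_aux (r12 r) (r23 r) ha hb
    (by
      rintro ⟨x, y, z⟩ e
      rw [fa]
      exact L x y (congrArg Prod.fst e))
    (by
      rintro ⟨x, y, z⟩ e1 e2
      rw [fa] at e1 e2
      rw [fb]
      have e1 : x = y := e1
      subst e1
      have e2 : x = (r (x, z)).1 := e2
      exact L x z e2.symm)
    (by
      rintro ⟨x, y, z⟩ e1 e2
      rw [fb] at e1 e2
      rw [fa]
      have e1 : y = z := e1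
      subst e1
      have e2 : (r (x, y)).2 = y := e2
      exact R x y e2)
  have d3 : ∀ p : X × X × X, p ∈ Diag3 ↔ (p ∈ Diag2X ∧ p ∈ XDiag2) := fun p => Iff.rfl
  have hB : IsBraided r ↔ ∀ p, r12 r (r23 r (r12 r p)) = r23 r (r12 r (r23 r p)) :=
    funext_iff
  rw [hB, M]
  refine and_congr ?_ ?_
  · constructor
    · rintro H O ⟨p, rfl⟩
      refine Iff.trans ?_ (H p)
      simp only [fa, fb]
      rfl
    · intro H p
      refine Iff.trans ?_ (H _ ⟨p, rfl⟩)
      simp only [fa, fb]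
      rfl
  · have E : ∀ p, (orbAux (r12 r) (r23 r) p ∩ (Diag2X ∪ XDiag2) = ∅ ↔
        ∀ q ∈ orbAux (r12 r) (r23 r) p, ¬ (r12 r q = q ∨ r23 r q = q)) := by
      intro p
      rw [Set.eq_empty_iff_forall_notMem]
      simp only [fa, fb, Set.mem_inter_iff, Set.mem_union, not_and]
    constructor
    · rintro H O ⟨p, rfl⟩
      exact (E p).trans (H p)
    · intro H p
      exact (E p).symm.trans (H _ ⟨p, rfl⟩)
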